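/- arXiv:1808.09905 — 6 statements merged into one kernel-verified Lean document; each statement's English description precedes it below -/
import Mathlib

section
/- Let C be a category with weak finite limits and binary products, and let X, Y be objects of C. Then every weak exponential of Y and X (with weak evaluation out of a weak product) is a full diagram from X to Y. -/
open CategoryTheory CategoryTheory.Limits

universe v u v₂ u₂

namespace Paper

variable {C : Type u} [Category.{v} C]

/-- A weak product of `Z` and `X`: every pair of morphisms into `Z` and `X`
factors (not necessarily uniquely) through the projections. -/
def IsWeakProduct {Z X V : C} (p₁ : V ⟶ Z) (p₂ : V ⟶ X) : Prop :=
  ∀ {W : C} (a : W ⟶ Z) (b : W ⟶ X), ∃ t : W ⟶ V, t ≫ p₁ = a ∧ t ≫ p₂ = b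

/-- `f` is determined by projections with respect to the span `(p₁, p₂)`. -/
def DeterminedByProjections {Z X V Y : C} (p₁ : V ⟶ Z) (p₂ : V ⟶ X) (f : V ⟶ Y) : Prop :=
  ∀ {W : C} (a b : W ⟶ V), a ≫ p₁ = b ≫ p₁ → a ≫ p₂ = b ≫ p₂ → a ≫ f = b ≫ f

/-- A weak pullback of `f` and `g` with projections `q₁`, `q₂`. -/
def IsWeakPullback {P A B Z : C} (q₁ : P ⟶ A) (q₂ : P ⟶ B) (f : A ⟶ Z) (g : B ⟶ Z) : Prop :=
  q₁ ≫ f = q₂ ≫ g ∧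
    ∀ {W : C} (a : W ⟶ A) (b : W ⟶ B), a ≫ f = b ≫ g →
      ∃ t : W ⟶ P, t ≫ q₁ = a ∧ t ≫ q₂ = b

/-- `(W, p₁ : V ⟶ W, p₂ : V ⟶ X, e : V ⟶ Y)` is a weak exponential of `Y` and `X`. -/
def IsWeakExponential {X Y W V : C} (p₁ : V ⟶ W) (p₂ : V ⟶ X) (e : V ⟶ Y) : Prop :=
  IsWeakProduct p₁ p₂ ∧ DeterminedByProjections p₁ p₂ e ∧
    ∀ {W' V' : C} (p₁' : V' ⟶ W') (p₂' : V' ⟶ X) (e' : V' ⟶ Y),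
      IsWeakProduct p₁' p₂' → DeterminedByProjections p₁' p₂' e' →
        ∃ (h : W' ⟶ W) (k : V' ⟶ V), k ≫ p₁ = p₁' ≫ h ∧ k ≫ p₂ = p₂' ∧ k ≫ e = e'

/-- A full diagram from `X` to `Y`. -/
def IsFullDiagram {X Y U V : C} (p₁ : V ⟶ U) (p₂ : V ⟶ X) (f : V ⟶ Y) : Prop :=
  IsWeakProduct p₁ p₂ ∧
    ∀ {U' V' : C} (p₁' : V' ⟶ U') (p₂' : V' ⟶ X) (f' : V' ⟶ Y), IsWeakProduct p₁' p₂' →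
      ∃ (h : U' ⟶ U) (P : C) (q₁ : P ⟶ U') (q₂ : P ⟶ V) (k : P ⟶ V'),
        IsWeakPullback q₁ q₂ h p₁ ∧ k ≫ p₁' = q₁ ∧ k ≫ p₂' = q₂ ≫ p₂ ∧ k ≫ f' = q₂ ≫ f

def HasFullDiagrams (C : Type u) [Category.{v} C] : Prop :=
  ∀ X Y : C, ∃ (U V : C) (p₁ : V ⟶ U) (p₂ : V ⟶ X) (f : V ⟶ Y), IsFullDiagram p₁ p₂ f

def HasWeakExponentials (C : Type u) [Category.{v} C] : Prop :=
  ∀ X Y : C, ∃ (W V : C) (p₁ : V ⟶ W) (p₂ : V ⟶ X) (e : V ⟶ Y), IsWeakExponential p₁ p₂ e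

/-- A dependent full diagram over `x : X ⟶ J` and `y : Y ⟶ X`. -/
def IsDepFullDiagram {J X Y U V : C} (x : X ⟶ J) (y : Y ⟶ X)
    (u : U ⟶ J) (p₁ : V ⟶ U) (p₂ : V ⟶ X) (f : V ⟶ Y) : Prop :=
  IsWeakPullback p₁ p₂ u x ∧ f ≫ y = p₂ ∧
    ∀ {U' V' : C} (u' : U' ⟶ J) (p₁' : V' ⟶ U') (p₂' : V' ⟶ X) (f' : V' ⟶ Y),
      IsWeakPullback p₁' p₂' u' x → f' ≫ y = p₂' →
        ∃ h : U' ⟶ U, h ≫ u = u' ∧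
          ∃ (P : C) (q₁ : P ⟶ V) (q₂ : P ⟶ U') (k : P ⟶ V'),
            IsWeakPullback q₁ q₂ p₁ h ∧ k ≫ p₁' = q₂ ∧ k ≫ f' = q₁ ≫ f

/-- A weak dependent product of `y : Y ⟶ X` and `x : X ⟶ J`. -/
def IsWeakDepProd {J X Y U V : C} (x : X ⟶ J) (y : Y ⟶ X)
    (u : U ⟶ J) (p₁ : V ⟶ U) (p₂ : V ⟶ X) (f : V ⟶ Y) : Prop :=
  IsWeakPullback p₁ p₂ u x ∧ f ≫ y = p₂ ∧ DeterminedByProjections p₁ p₂ f ∧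
    ∀ {U' V' : C} (u' : U' ⟶ J) (p₁' : V' ⟶ U') (p₂' : V' ⟶ X) (f' : V' ⟶ Y),
      IsWeakPullback p₁' p₂' u' x → f' ≫ y = p₂' →
        ∃ (h : U' ⟶ U) (k : V' ⟶ V),
          h ≫ u = u' ∧ k ≫ p₁ = p₁' ≫ h ∧ k ≫ p₂ = p₂' ∧ k ≫ f = f'

def HasDepFullDiagrams (C : Type u) [Category.{v} C] : Prop :=
  ∀ {J X Y : C} (x : X ⟶ J) (y : Y ⟶ X),
    ∃ (U V : C) (u : U ⟶ J) (p₁ : V ⟶ U) (p₂ : V ⟶ X) (f : V ⟶ Y),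
      IsDepFullDiagram x y u p₁ p₂ f

def HasWeakDepProds (C : Type u) [Category.{v} C] : Prop :=
  ∀ {J X Y : C} (x : X ⟶ J) (y : Y ⟶ X),
    ∃ (U V : C) (u : U ⟶ J) (p₁ : V ⟶ U) (p₂ : V ⟶ X) (f : V ⟶ Y),
      IsWeakDepProd x y u p₁ p₂ f

/-- A category has weak finite limits if every finite diagram admits a weak limit,
i.e. a cone through which every cone factors (not necessarily uniquely). -/
def HasWeakFiniteLimits (C : Type u) [Category.{v} C] : Prop :=
  ∀ (J : Type) (_ : SmallCategory J) (_ : FinCategory J) (F : J ⥤ C),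
    ∃ c : Cone F, ∀ d : Cone F, Nonempty (d ⟶ c)

end Paper
namespace Paper

/-- A category with weak finite limits has weak pullbacks. -/
theorem HasWeakFiniteLimits.exists_isWeakPullback {C : Type u} [Category.{v} C]
    (hC : HasWeakFiniteLimits C) {A B Z : C} (f : A ⟶ Z) (g : B ⟶ Z) :
    ∃ (P : C) (q₁ : P ⟶ A) (q₂ : P ⟶ B), IsWeakPullback q₁ q₂ f g := by
  obtain ⟨c, hc⟩ := hC WalkingCospan inferInstance inferInstance (cospan f g)
  refine ⟨c.pt, PullbackCone.fst c, PullbackCone.snd c, PullbackCone.condition c, ?_⟩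
  intro T a b hab
  obtain ⟨t⟩ := hc (PullbackCone.mk a b hab)
  exact ⟨t.hom, t.w WalkingCospan.left, t.w WalkingCospan.right⟩

/-- The binary product is a weak product. -/
theorem isWeakProduct_prod {C : Type u} [Category.{v} C] (Z X : C) [HasBinaryProduct Z X] :
    IsWeakProduct (prod.fst : Z ⨯ X ⟶ Z) prod.snd :=
  fun a b => ⟨prod.lift a b, prod.lift_fst a b, prod.lift_snd a b⟩

/-- Every morphism out of a binary product is determined by projections. -/
theorem determinedByProjections_prod {C : Type u} [Category.{v} C] {Z X Y : C}
    [HasBinaryProduct Z X] (f : Z ⨯ X ⟶ Y) :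
    DeterminedByProjections prod.fst prod.snd f :=
  fun _ _ h₁ h₂ => congrArg (· ≫ f) (Limits.prod.hom_ext h₁ h₂)

/-- In a category with weak finite limits and binary products,
every weak exponential of `Y` and `X` is a full diagram from `X` to `Y`. -/
theorem weakExponential_isFullDiagram
    {C : Type u} [Category.{v} C] [HasBinaryProducts C]
    (hwfl : HasWeakFiniteLimits C) {X Y W V : C}
    (p₁ : V ⟶ W) (p₂ : V ⟶ X) (e : V ⟶ Y)
    (hwe : IsWeakExponential p₁ p₂ e) :
    IsFullDiagram p₁ p₂ e := by
  obtain ⟨hV, he, hexp⟩ := hwe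
  refine ⟨hV, fun {U' V'} p₁' p₂' f' hV' => ?_⟩
  obtain ⟨s, hs₁, hs₂⟩ := hV' (prod.fst : U' ⨯ X ⟶ U') prod.snd
  obtain ⟨h, m, hm₁, hm₂, hme⟩ := hexp prod.fst prod.snd (s ≫ f')
    (isWeakProduct_prod U' X) (determinedByProjections_prod _)
  obtain ⟨P, q₁, q₂, hP⟩ := hwfl.exists_isWeakPullback h p₁
  obtain ⟨t, ht₁, ht₂⟩ := isWeakProduct_prod U' X q₁ (q₂ ≫ p₂)
  refine ⟨h, P, q₁, q₂, t ≫ s, hP, by rw [Category.assoc, hs₁, ht₁],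
    by rw [Category.assoc, hs₂, ht₂], ?_⟩
  have htm : (t ≫ m) ≫ e = q₂ ≫ e :=
    he _ _ (by rw [Category.assoc, hm₁, ← Category.assoc, ht₁, hP.1])
      (by rw [Category.assoc, hm₂, ht₂])
  rw [Category.assoc, ← hme, ← Category.assoc, htm]

end Paper
end

section
/- Let E be an exact category and P a projective cover of E (so that E is equivalent to the exact completion of P). Then E has right adjoints to inverse images along every morphism if and only if P has right adjoints to weak pullback functors. -/
open CategoryTheory CategoryTheory.Limits

universe v u v₂ u₂

namespace Paper

variable {E : Type u} [Category.{v} E]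

/-- An internal equivalence relation, expressed via generalized elements:
the pair `(r₁, r₂)` is jointly monic, reflexive, symmetric and transitive. -/
def IsInternalEquivRel {R X : E} (r₁ r₂ : R ⟶ X) : Prop :=
  (∀ {W : E} (a b : W ⟶ R), a ≫ r₁ = b ≫ r₁ → a ≫ r₂ = b ≫ r₂ → a = b) ∧
  (∀ {W : E} (x : W ⟶ X), ∃ d : W ⟶ R, d ≫ r₁ = x ∧ d ≫ r₂ = x) ∧
  (∀ {W : E} (a : W ⟶ R), ∃ b : W ⟶ R, b ≫ r₁ = a ≫ r₂ ∧ b ≫ r₂ = a ≫ r₁) ∧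
  (∀ {W : E} (a b : W ⟶ R), a ≫ r₂ = b ≫ r₁ →
    ∃ c : W ⟶ R, c ≫ r₁ = a ≫ r₁ ∧ c ≫ r₂ = b ≫ r₂)

/-- A Barr-exact category: a regular category (finite limits together with
pullback-stable regular epi–mono factorisations) in which every internal
equivalence relation is effective (is a kernel pair). -/
class ExactCategory (E : Type u) [Category.{v} E] : Prop where
  hasFiniteLimits : HasFiniteLimits E
  regEpiMonoFactorisation : ∀ {A B : E} (f : A ⟶ B),
    ∃ (I : E) (e : A ⟶ I) (m : I ⟶ B), Nonempty (RegularEpi e) ∧ Mono m ∧ e ≫ m = f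
  regEpiStable : ∀ {A B X P : E} (f : A ⟶ B) (g : X ⟶ B) (p₁ : P ⟶ A) (p₂ : P ⟶ X),
    IsPullback p₁ p₂ f g → Nonempty (RegularEpi f) → Nonempty (RegularEpi p₂)
  equivRelEffective : ∀ {R X : E} (r₁ r₂ : R ⟶ X), IsInternalEquivRel r₁ r₂ →
    ∃ (Y : E) (q : X ⟶ Y), IsKernelPair q r₁ r₂

attribute [instance] ExactCategory.hasFiniteLimits

/-- `P` is (the object class of) a projective cover of `E`: every object satisfying `P`
is regular projective and every object of `E` is covered by a regular epi from an
object satisfying `P`. -/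
def IsProjectiveCover (P : E → Prop) : Prop :=
  (∀ {X : E}, P X → ∀ {A B : E} (g : A ⟶ B), Nonempty (RegularEpi g) →
    ∀ f : X ⟶ B, ∃ f' : X ⟶ A, f' ≫ g = f) ∧
  (∀ A : E, ∃ (X : E) (p : X ⟶ A), P X ∧ Nonempty (RegularEpi p))

section Relative

variable (P : E → Prop)

/-- Weak product relative to the full subcategory on `P`. -/
def IsWeakProductOn {Z X V : E} (p₁ : V ⟶ Z) (p₂ : V ⟶ X) : Prop :=
  ∀ {W : E}, P W → ∀ (a : W ⟶ Z) (b : W ⟶ X), ∃ t : W ⟶ V, t ≫ p₁ = a ∧ t ≫ p₂ = b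

/-- Determined by projections, relative to the full subcategory on `P`. -/
def DeterminedByProjectionsOn {Z X V Y : E} (p₁ : V ⟶ Z) (p₂ : V ⟶ X) (f : V ⟶ Y) : Prop :=
  ∀ {W : E}, P W → ∀ (a b : W ⟶ V), a ≫ p₁ = b ≫ p₁ → a ≫ p₂ = b ≫ p₂ → a ≫ f = b ≫ f

/-- Weak pullback relative to the full subcategory on `P`. -/
def IsWeakPullbackOn {Q A B Z : E} (q₁ : Q ⟶ A) (q₂ : Q ⟶ B) (f : A ⟶ Z) (g : B ⟶ Z) : Prop :=
  q₁ ≫ f = q₂ ≫ g ∧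
    ∀ {W : E}, P W → ∀ (a : W ⟶ A) (b : W ⟶ B), a ≫ f = b ≫ g →
      ∃ t : W ⟶ Q, t ≫ q₁ = a ∧ t ≫ q₂ = b

/-- Full diagram from `X` to `Y` relative to the full subcategory on `P`. -/
def IsFullDiagramOn {X Y U V : E} (p₁ : V ⟶ U) (p₂ : V ⟶ X) (f : V ⟶ Y) : Prop :=
  IsWeakProductOn P p₁ p₂ ∧
    ∀ {U' V' : E}, P U' → P V' → ∀ (p₁' : V' ⟶ U') (p₂' : V' ⟶ X) (f' : V' ⟶ Y),
      IsWeakProductOn P p₁' p₂' →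
        ∃ (h : U' ⟶ U) (Q : E) (_ : P Q) (q₁ : Q ⟶ U') (q₂ : Q ⟶ V) (k : Q ⟶ V'),
          IsWeakPullbackOn P q₁ q₂ h p₁ ∧ k ≫ p₁' = q₁ ∧ k ≫ p₂' = q₂ ≫ p₂ ∧ k ≫ f' = q₂ ≫ f

/-- The full subcategory on `P` has full diagrams. -/
def HasFullDiagramsOn : Prop :=
  ∀ {X Y : E}, P X → P Y →
    ∃ (U V : E) (_ : P U) (_ : P V) (p₁ : V ⟶ U) (p₂ : V ⟶ X) (f : V ⟶ Y),
      IsFullDiagramOn P p₁ p₂ f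

/-- Weak exponential relative to the full subcategory on `P`. -/
def IsWeakExponentialOn {X Y W V : E} (p₁ : V ⟶ W) (p₂ : V ⟶ X) (e : V ⟶ Y) : Prop :=
  IsWeakProductOn P p₁ p₂ ∧ DeterminedByProjectionsOn P p₁ p₂ e ∧
    ∀ {W' V' : E}, P W' → P V' → ∀ (p₁' : V' ⟶ W') (p₂' : V' ⟶ X) (e' : V' ⟶ Y),
      IsWeakProductOn P p₁' p₂' → DeterminedByProjectionsOn P p₁' p₂' e' →
        ∃ (h : W' ⟶ W) (k : V' ⟶ V), k ≫ p₁ = p₁' ≫ h ∧ k ≫ p₂ = p₂' ∧ k ≫ e = e'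

/-- The full subcategory on `P` has weak exponentials. -/
def HasWeakExponentialsOn : Prop :=
  ∀ {X Y : E}, P X → P Y →
    ∃ (W V : E) (_ : P W) (_ : P V) (p₁ : V ⟶ W) (p₂ : V ⟶ X) (e : V ⟶ Y),
      IsWeakExponentialOn P p₁ p₂ e

/-- Dependent full diagram relative to the full subcategory on `P`. -/
def IsDepFullDiagramOn {J X Y U V : E} (x : X ⟶ J) (y : Y ⟶ X)
    (u : U ⟶ J) (p₁ : V ⟶ U) (p₂ : V ⟶ X) (f : V ⟶ Y) : Prop :=
  IsWeakPullbackOn P p₁ p₂ u x ∧ f ≫ y = p₂ ∧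
    ∀ {U' V' : E}, P U' → P V' → ∀ (u' : U' ⟶ J) (p₁' : V' ⟶ U') (p₂' : V' ⟶ X) (f' : V' ⟶ Y),
      IsWeakPullbackOn P p₁' p₂' u' x → f' ≫ y = p₂' →
        ∃ h : U' ⟶ U, h ≫ u = u' ∧
          ∃ (Q : E) (_ : P Q) (q₁ : Q ⟶ V) (q₂ : Q ⟶ U') (k : Q ⟶ V'),
            IsWeakPullbackOn P q₁ q₂ p₁ h ∧ k ≫ p₁' = q₂ ∧ k ≫ f' = q₁ ≫ f

/-- The full subcategory on `P` has dependent full diagrams. -/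
def HasDepFullDiagramsOn : Prop :=
  ∀ {J X Y : E}, P J → P X → P Y → ∀ (x : X ⟶ J) (y : Y ⟶ X),
    ∃ (U V : E) (_ : P U) (_ : P V) (u : U ⟶ J) (p₁ : V ⟶ U) (p₂ : V ⟶ X) (f : V ⟶ Y),
      IsDepFullDiagramOn P x y u p₁ p₂ f

/-- Weak dependent product relative to the full subcategory on `P`. -/
def IsWeakDepProdOn {J X Y U V : E} (x : X ⟶ J) (y : Y ⟶ X)
    (u : U ⟶ J) (p₁ : V ⟶ U) (p₂ : V ⟶ X) (f : V ⟶ Y) : Prop :=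
  IsWeakPullbackOn P p₁ p₂ u x ∧ f ≫ y = p₂ ∧ DeterminedByProjectionsOn P p₁ p₂ f ∧
    ∀ {U' V' : E}, P U' → P V' → ∀ (u' : U' ⟶ J) (p₁' : V' ⟶ U') (p₂' : V' ⟶ X) (f' : V' ⟶ Y),
      IsWeakPullbackOn P p₁' p₂' u' x → f' ≫ y = p₂' →
        ∃ (h : U' ⟶ U) (k : V' ⟶ V),
          h ≫ u = u' ∧ k ≫ p₁ = p₁' ≫ h ∧ k ≫ p₂ = p₂' ∧ k ≫ f = f'

/-- The full subcategory on `P` has weak dependent products. -/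
def HasWeakDepProdsOn : Prop :=
  ∀ {J X Y : E}, P J → P X → P Y → ∀ (x : X ⟶ J) (y : Y ⟶ X),
    ∃ (U V : E) (_ : P U) (_ : P V) (u : U ⟶ J) (p₁ : V ⟶ U) (p₂ : V ⟶ X) (f : V ⟶ Y),
      IsWeakDepProdOn P x y u p₁ p₂ f

/-- An object over `X` with vertex in the full subcategory on `P`. -/
structure OverIn (X : E) where
  V : E
  hV : P V
  hom : V ⟶ X

/-- The preorder on `OverIn P X` whose poset reflection is the poset reflection
of the slice category of the full subcategory on `P` over `X`. -/
instance {X : E} : Preorder (OverIn P X) where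
  le a b := ∃ t : a.V ⟶ b.V, t ≫ b.hom = a.hom
  le_refl a := ⟨𝟙 _, by simp⟩
  le_trans a b c := by
    rintro ⟨t, ht⟩ ⟨s, hs⟩
    exact ⟨t ≫ s, by simp [Category.assoc, hs, ht]⟩

/-- The full subcategory on `P` has right adjoints to the (poset-reflected)
weak pullback functors along all of its morphisms. -/
def HasRightAdjointsToWeakPullbacksOn : Prop :=
  ∀ {X Y : E}, P X → P Y → ∀ f : Y ⟶ X,
    ∃ wp : OverIn P X → OverIn P Y,
      (∀ a : OverIn P X, ∃ m : (wp a).V ⟶ a.V,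
        IsWeakPullbackOn P m (wp a).hom a.hom f) ∧
      ∃ ra : OverIn P Y → OverIn P X,
        ∀ (a : OverIn P X) (b : OverIn P Y), wp a ≤ b ↔ a ≤ ra b

end Relative

/-- `ev : W ⨯ X ⟶ Y` exhibits `W` as an exponential of `Y` by `X`. -/
def IsExponential [HasBinaryProducts E] (X Y W : E) (ev : W ⨯ X ⟶ Y) : Prop :=
  ∀ {Z : E} (g : Z ⨯ X ⟶ Y), ∃! h : Z ⟶ W, prod.map h (𝟙 X) ≫ ev = g

/-- A category with binary products is cartesian closed if every pair of objects
has an exponential. -/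
def IsCartesianClosed (E : Type u) [Category.{v} E] [HasBinaryProducts E] : Prop :=
  ∀ X Y : E, ∃ (W : E) (ev : W ⨯ X ⟶ Y), IsExponential X Y W ev

/-- A category with finite limits is locally cartesian closed if all its slices
are cartesian closed. -/
def IsLocallyCartesianClosed (E : Type u) [Category.{v} E] [HasFiniteLimits E] : Prop :=
  ∀ X : E, IsCartesianClosed (Over X)

end Paper
namespace Paper

section SubobjectElements

variable {E : Type u} [Category.{v} E]

lemma subobject_pullback_factors_iff [HasPullbacks E] {A B W : E} (f : A ⟶ B) (T : Subobject B)
    (h : W ⟶ A) : ((Subobject.pullback f).obj T).Factors h ↔ T.Factors (h ≫ f) := by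
  have sq := Subobject.isPullback f T
  constructor
  · intro hh
    refine (Subobject.factors_iff _ _).2 ⟨Subobject.factorThru _ h hh ≫ Subobject.pullbackπ f T, ?_⟩
    change (_ ≫ Subobject.pullbackπ f T) ≫ T.arrow = _
    rw [Category.assoc, sq.w, ← Category.assoc, Subobject.factorThru_arrow]
  · intro hh
    have w : Subobject.factorThru _ _ hh ≫ T.arrow = h ≫ f := Subobject.factorThru_arrow _ _ hh
    exact (Subobject.factors_iff _ _).2 ⟨sq.lift _ _ w, sq.lift_snd _ _ w⟩

lemma IsProjectiveCover.subobject_le_iff {P : E → Prop} (hP : IsProjectiveCover P) {A : E}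
    (M N : Subobject A) :
    M ≤ N ↔ ∀ {W : E}, P W → ∀ h : W ⟶ A, M.Factors h → N.Factors h := by
  constructor
  · intro hMN W _ h hM
    exact Subobject.factors_of_le h hMN hM
  · intro H
    obtain ⟨X, p, hX, ⟨hp⟩⟩ := hP.2 (M : E)
    have hN : N.Factors (p ≫ M.arrow) := H hX _ (Subobject.factors_comp_arrow p)
    have : IsRegularEpi p := ⟨⟨hp⟩⟩
    have : StrongEpi p := inferInstance
    have sq : CommSq (N.factorThru _ hN) p N.arrow M.arrow := ⟨Subobject.factorThru_arrow _ _ hN⟩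
    exact Subobject.le_of_comm sq.lift sq.fac_right

/-- The subobject whose elements, from objects of a projective cover, are those of the image
of a morphism. -/
lemma IsProjectiveCover.exists_image [ExactCategory E] {P : E → Prop} (hP : IsProjectiveCover P)
    {A B : E} (g : A ⟶ B) :
    ∃ M : Subobject B, ∀ {W : E}, P W → ∀ h : W ⟶ B, M.Factors h ↔ ∃ t : W ⟶ A, t ≫ g = h := by
  obtain ⟨I, e, m, he, hm, rfl⟩ := ExactCategory.regEpiMonoFactorisation g
  refine ⟨Subobject.mk m, fun {W} hW h => ?_⟩
  rw [Subobject.mk_factors_iff]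
  constructor
  · rintro ⟨s, hs⟩
    obtain ⟨t, ht⟩ := hP.1 hW e he s
    exact ⟨t, by rw [← Category.assoc, ht]; exact hs⟩
  · rintro ⟨t, ht⟩
    exact ⟨t ≫ e, by rw [← ht]; exact Category.assoc _ _ _⟩

/-- Every subobject is the image of an object of the projective cover. -/
lemma IsProjectiveCover.exists_overIn {P : E → Prop} (hP : IsProjectiveCover P) {A : E}
    (M : Subobject A) :
    ∃ a : OverIn P A, ∀ {W : E}, P W → ∀ h : W ⟶ A,
      M.Factors h ↔ ∃ t : W ⟶ a.V, t ≫ a.hom = h := by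
  obtain ⟨X, p, hX, hp⟩ := hP.2 (M : E)
  refine ⟨⟨X, hX, p ≫ M.arrow⟩, fun {W} hW h => ⟨fun hh => ?_, ?_⟩⟩
  · obtain ⟨t, ht⟩ := hP.1 hW p hp (M.factorThru h hh)
    exact ⟨t, by rw [← Category.assoc, ht, Subobject.factorThru_arrow]⟩
  · rintro ⟨t, rfl⟩
    rw [← Category.assoc]
    exact Subobject.factors_comp_arrow _

/-- Weak pullbacks exist in a projective cover. -/
lemma IsProjectiveCover.exists_weakPullback [HasPullbacks E] {P : E → Prop}
    (hP : IsProjectiveCover P) {A B C : E} (f : A ⟶ C) (g : B ⟶ C) :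
    ∃ (Q : E) (_ : P Q) (q₁ : Q ⟶ A) (q₂ : Q ⟶ B), IsWeakPullbackOn P q₁ q₂ f g := by
  obtain ⟨Q, p, hQ, hp⟩ := hP.2 (pullback f g)
  refine ⟨Q, hQ, p ≫ pullback.fst f g, p ≫ pullback.snd f g,
    by simp [pullback.condition], fun {W} hW a b hab => ?_⟩
  obtain ⟨t, ht⟩ := hP.1 hW p hp (pullback.lift a b hab)
  exact ⟨t, by rw [← Category.assoc, ht, pullback.lift_fst],
    by rw [← Category.assoc, ht, pullback.lift_snd]⟩

lemma isLeftAdjoint_of_forall_le_iff {α β : Type*} [Preorder α] [Preorder β] (F : α ⥤ β)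
    (G : β → α) (h : ∀ a b, F.obj a ≤ b ↔ a ≤ G b) : F.IsLeftAdjoint := by
  have gc : GaloisConnection F.obj G := h
  exact gc.adjunction.isLeftAdjoint

/-- Inequalities out of a weak pullback, in terms of elements. -/
lemma weakPullback_le_iff {P : E → Prop} {X Y : E} (f : Y ⟶ X) (a : OverIn P X) (c b : OverIn P Y)
    (hc : ∃ m : c.V ⟶ a.V, IsWeakPullbackOn P m c.hom a.hom f) :
    c ≤ b ↔ ∀ {W : E}, P W → ∀ (w : W ⟶ a.V) (y : W ⟶ Y), w ≫ a.hom = y ≫ f →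
      ∃ t : W ⟶ b.V, t ≫ b.hom = y := by
  obtain ⟨m, hm, lift⟩ := hc
  constructor
  · rintro ⟨t, ht⟩ W hW w y hwy
    obtain ⟨s, -, hs⟩ := lift hW w y hwy
    exact ⟨s ≫ t, by rw [Category.assoc, ht, hs]⟩
  · intro H
    exact H c.hV m c.hom hm

/-- A subobject whose elements are as for the universal quantification along `f` represents
the right adjoint of the inverse image. -/
lemma IsProjectiveCover.pullback_le_iff [HasPullbacks E] {P : E → Prop} (hP : IsProjectiveCover P)
    {A B : E} (f : A ⟶ B) (S : Subobject A) (M : Subobject B)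
    (hM : ∀ {W : E}, P W → ∀ b : W ⟶ B, M.Factors b ↔
      ∀ {W' : E}, P W' → ∀ (w : W' ⟶ W) (a : W' ⟶ A), w ≫ b = a ≫ f → S.Factors a)
    (T : Subobject B) : (Subobject.pullback f).obj T ≤ S ↔ T ≤ M := by
  rw [hP.subobject_le_iff, hP.subobject_le_iff]
  constructor
  · intro H W hW b hb
    refine (hM hW b).2 fun {W'} hW' w a hwa => H hW' a ?_
    rw [subobject_pullback_factors_iff, ← hwa]
    exact Subobject.factors_of_factors_right w hb
  · intro H W hW a ha
    rw [subobject_pullback_factors_iff] at ha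
    exact (hM hW _).1 (H hW _ ha) hW (𝟙 W) a (Category.id_comp _)

/-- Conversely, a right adjoint of the inverse image has the expected elements. -/
lemma IsProjectiveCover.factors_iff_of_pullback_le_iff [ExactCategory E] {P : E → Prop}
    (hP : IsProjectiveCover P) {A B : E} (f : A ⟶ B) (S : Subobject A) (M : Subobject B)
    (hM : ∀ T : Subobject B, (Subobject.pullback f).obj T ≤ S ↔ T ≤ M)
    {W : E} (hW : P W) (b : W ⟶ B) :
    M.Factors b ↔
      ∀ {W' : E}, P W' → ∀ (w : W' ⟶ W) (a : W' ⟶ A), w ≫ b = a ≫ f → S.Factors a := by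
  constructor
  · intro hb W' hW' w a hwa
    refine Subobject.factors_of_le a ((hM M).2 le_rfl) ?_
    rw [subobject_pullback_factors_iff, ← hwa]
    exact Subobject.factors_of_factors_right w hb
  · intro H
    obtain ⟨T, hT⟩ := hP.exists_image b
    refine Subobject.factors_of_le b ((hM T).1 ?_) ((hT hW b).2 ⟨𝟙 W, Category.id_comp _⟩)
    rw [hP.subobject_le_iff]
    intro W' hW' a ha
    rw [subobject_pullback_factors_iff, hT hW'] at ha
    obtain ⟨w, hw⟩ := ha
    exact H hW' w a hw

lemma IsProjectiveCover.exists_forall_subobject [ExactCategory E] {P : E → Prop}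
    (hP : IsProjectiveCover P) (h : HasRightAdjointsToWeakPullbacksOn P) {A B : E} (f : A ⟶ B)
    (S : Subobject A) :
    ∃ M : Subobject B, ∀ T : Subobject B, (Subobject.pullback f).obj T ≤ S ↔ T ≤ M := by
  obtain ⟨Y, q, hY, hq⟩ := hP.2 B
  obtain ⟨X, hX, p, g, hpg, lift⟩ := hP.exists_weakPullback f q
  obtain ⟨wp, hwp, ra, hra⟩ := h hY hX g
  obtain ⟨s, hs⟩ := hP.exists_overIn ((Subobject.pullback p).obj S)
  obtain ⟨M, hM⟩ := hP.exists_image ((ra s).hom ≫ q)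
  have key : ∀ {W : E}, P W → ∀ y : W ⟶ Y, (∃ t : W ⟶ (ra s).V, t ≫ (ra s).hom = y) ↔
      ∀ {W' : E}, P W' → ∀ (w : W' ⟶ W) (a : W' ⟶ A), w ≫ y ≫ q = a ≫ f → S.Factors a := by
    intro W hW y
    have e : (∃ t : W ⟶ (ra s).V, t ≫ (ra s).hom = y) ↔ wp ⟨W, hW, y⟩ ≤ s :=
      (hra ⟨W, hW, y⟩ s).symm
    rw [e, weakPullback_le_iff g ⟨W, hW, y⟩ _ s (hwp _)]
    constructor
    · intro H W' hW' w a hwa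
      obtain ⟨x, rfl, hx⟩ := lift hW' a (w ≫ y) (by rw [← hwa, Category.assoc])
      rw [← subobject_pullback_factors_iff, hs hW']
      exact H hW' w x hx.symm
    · intro H W' hW' w x hwx
      rw [← hs hW', subobject_pullback_factors_iff]
      refine H hW' w _ ?_
      rw [Category.assoc, hpg, ← Category.assoc, hwx, Category.assoc]
  refine ⟨M, hP.pullback_le_iff f S M fun {W} hW b => ?_⟩
  rw [hM hW]
  obtain ⟨y, rfl⟩ := hP.1 hW q hq b
  constructor
  · rintro ⟨t, ht⟩ W' hW' w a hwa
    refine (key hW (t ≫ (ra s).hom)).1 ⟨t, rfl⟩ hW' w a ?_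
    rw [← hwa, ← ht, Category.assoc]
  · intro H
    obtain ⟨t, ht⟩ := (key hW y).2 H
    exact ⟨t, by rw [← Category.assoc, ht]⟩

lemma IsProjectiveCover.hasRightAdjointsToWeakPullbacksOn [ExactCategory E] {P : E → Prop}
    (hP : IsProjectiveCover P)
    (h : ∀ {A B : E} (f : A ⟶ B) (S : Subobject A),
      ∃ M : Subobject B, ∀ T : Subobject B, (Subobject.pullback f).obj T ≤ S ↔ T ≤ M) :
    HasRightAdjointsToWeakPullbacksOn P := by
  intro X Y hX hY f
  have hwp : ∀ a : OverIn P X, ∃ c : OverIn P Y, ∃ m : c.V ⟶ a.V,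
      IsWeakPullbackOn P m c.hom a.hom f := fun a => by
    obtain ⟨Q, hQ, q₁, q₂, hq⟩ := hP.exists_weakPullback a.hom f
    exact ⟨⟨Q, hQ, q₂⟩, q₁, hq⟩
  choose wp hwp using hwp
  have hra : ∀ b : OverIn P Y, ∃ c : OverIn P X, ∀ a : OverIn P X, wp a ≤ b ↔ a ≤ c := fun b => by
    obtain ⟨S, hS⟩ := hP.exists_image b.hom
    obtain ⟨M, hM⟩ := h f S
    obtain ⟨c, hc⟩ := hP.exists_overIn M
    refine ⟨c, fun a => ?_⟩
    have e : a ≤ c ↔ M.Factors a.hom := (hc a.hV a.hom).symm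
    rw [e, hP.factors_iff_of_pullback_le_iff f S M hM a.hV,
      weakPullback_le_iff f a _ b (hwp a)]
    constructor
    · intro H W hW w y hwy
      exact (hS hW y).2 (H hW w y hwy)
    · intro H W hW w y hwy
      exact (hS hW y).1 (H hW w y hwy)
  choose ra hra using hra
  exact ⟨wp, hwp, ra, fun a b => hra b a⟩

end SubobjectElements

/-- An exact category `E` with a projective cover `P` has right
adjoints to inverse images along every morphism iff `P` has right adjoints to
the weak pullback functors between the poset reflections of its slices. -/
theorem rightAdjoints_inverseImages_iff_weakPullbackAdjoints
    {E : Type u} [Category.{v} E] [ExactCategory E]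
    (P : E → Prop) (hP : IsProjectiveCover P) :
    (∀ {A B : E} (f : A ⟶ B), (Subobject.pullback f).IsLeftAdjoint) ↔
      HasRightAdjointsToWeakPullbacksOn P := by
  constructor
  · intro H
    refine hP.hasRightAdjointsToWeakPullbacksOn fun {A B} f S => ?_
    have := H f
    let adj := Adjunction.ofIsLeftAdjoint (Subobject.pullback f)
    exact ⟨(Functor.rightAdjoint (Subobject.pullback f)).obj S, fun T => adj.gc T S⟩
  · intro H A B f
    choose G hG using fun S => hP.exists_forall_subobject H f S
    exact isLeftAdjoint_of_forall_le_iff _ G fun T S => hG S T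

end Paper
end

section
/- Let E be an exact category with a projective cover P, and suppose that E has right adjoints to inverse images along any morphism. If P has full diagrams, then for every object X in P and every object B in E there exist an object W in P and a morphism e : W × X → B in E that are weakly terminal with respect to objects of P over X and B: for every object Z in P and morphism g : Z × X → B in E there exists h : Z → W in P with e ∘ (h × X) = g. -/
open CategoryTheory CategoryTheory.Limits

universe v u v₂ u₂

namespace Paper

/-- Universal quantification of an equation `a = b` along `r : R ⟶ U`: a morphism `h : Z ⟶ U`
factors through the resulting subobject of `U` as soon as `a` and `b` agree on the fibre product
of `h` and `r`. -/
theorem exists_forall_eq_subobject {E : Type u} [Category.{v} E] [ExactCategory E]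
    {R U B : E} (r : R ⟶ U) [(Subobject.pullback r).IsLeftAdjoint] (a b : R ⟶ B) :
    ∃ (S : E) (i : S ⟶ U),
      (∀ {T : E} (t : T ⟶ R) (s : T ⟶ S), s ≫ i = t ≫ r → t ≫ a = t ≫ b) ∧
      ∀ {Z : E} (h : Z ⟶ U),
        (∀ {T : E} (t : T ⟶ R) (z : T ⟶ Z), z ≫ h = t ≫ r → t ≫ a = t ≫ b) →
          ∃ l : Z ⟶ S, l ≫ i = h := by
  let adj := Adjunction.ofIsLeftAdjoint (Subobject.pullback r)
  let M : Subobject R := Subobject.mk (equalizer.ι a b)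
  let S : Subobject U := (Subobject.pullback r).rightAdjoint.obj M
  refine ⟨S, S.arrow, fun t s hs => ?_, fun {Z} h H => ?_⟩
  · have hle : (Subobject.pullback r).obj S ≤ M := (adj.counit.app M).le
    have hM : M.Factors t := Subobject.factors_of_le t hle
      ((Subobject.factors_iff _ _).2
        ⟨(Subobject.isPullback r S).lift s t hs, (Subobject.isPullback r S).lift_snd _ _ _⟩)
    have ht : M.factorThru t hM ≫ (Subobject.underlyingIso _).hom ≫ equalizer.ι a b = t := by
      simp [M]
    rw [← ht]
    simp only [Category.assoc]
    exact _ ≫= (_ ≫= equalizer.condition a b)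
  · obtain ⟨I, e, m, he, hm, rfl⟩ := ExactCategory.regEpiMonoFactorisation h
    let N := (Subobject.pullback r).obj (Subobject.mk m)
    have hpb := Subobject.isPullback r (Subobject.mk m)
    let n := Subobject.pullbackπ r (Subobject.mk m) ≫ (Subobject.underlyingIso m).hom
    have hn : n ≫ m = N.arrow ≫ r := by simpa [n] using hpb.w
    have : Epi (pullback.snd e n) :=
      (ExactCategory.regEpiStable e n _ _ (IsPullback.of_hasPullback e n) he).some.epi
    have hN : N.arrow ≫ a = N.arrow ≫ b := by
      rw [← cancel_epi (pullback.snd e n)]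
      simpa using H (pullback.snd e n ≫ N.arrow) (pullback.fst e n)
        (by rw [pullback.condition_assoc, hn, Category.assoc])
    have hNM : N ≤ M := Subobject.le_mk_of_comm (equalizer.lift _ hN) (by simp)
    have hS : Subobject.mk m ≤ S := ((adj.homEquiv _ _) hNM.hom).le
    exact ⟨e ≫ Subobject.ofMkLE m S hS, by simp⟩

/-- If `E` is exact with projective cover `P` and has right
adjoints to inverse images, and `P` has full diagrams, then for all `X` in `P`
and `B` in `E` there are `W` in `P` and `e : W ⨯ X ⟶ B` weakly terminal among
morphisms `Z ⨯ X ⟶ B` with `Z` in `P`. -/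
theorem weakEvaluation_of_fullDiagrams
    {E : Type u} [Category.{v} E] [ExactCategory E]
    (P : E → Prop) (hP : IsProjectiveCover P)
    (hadj : ∀ {A B : E} (f : A ⟶ B), (Subobject.pullback f).IsLeftAdjoint)
    (hfull : HasFullDiagramsOn P) :
    ∀ {X : E}, P X → ∀ B : E,
      ∃ (W : E) (_ : P W) (e : (W ⨯ X : E) ⟶ B),
        ∀ {Z : E}, P Z → ∀ g : (Z ⨯ X : E) ⟶ B,
          ∃ h : Z ⟶ W, prod.map h (𝟙 X) ≫ e = g := by
  intro X hX B
  obtain ⟨lift, cover⟩ := hP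
  obtain ⟨Y, y, hY, hy⟩ := cover B
  obtain ⟨U, V, -, -, p₁, p₂, f, hprod, hf⟩ := hfull hX hY
  let w : V ⟶ U ⨯ X := prod.lift p₁ p₂
  have hw₁ : w ≫ prod.fst = p₁ := prod.lift_fst _ _
  have hw₂ : w ≫ prod.snd = p₂ := prod.lift_snd _ _
  have := hadj (pullback.fst w w ≫ p₁)
  obtain ⟨S, i, hSeq, hSfac⟩ := exists_forall_eq_subobject (pullback.fst w w ≫ p₁)
    (pullback.fst w w ≫ f ≫ y) (pullback.snd w w ≫ f ≫ y)
  obtain ⟨W, j, hW, hj⟩ := cover S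
  obtain ⟨T, c, hT, ⟨hc⟩⟩ := cover (W ⨯ X)
  obtain ⟨t, ht₁, ht₂⟩ := hprod hT (c ≫ prod.fst ≫ j ≫ i) (c ≫ prod.snd)
  have htw : t ≫ w = c ≫ prod.map (j ≫ i) (𝟙 X) := by ext <;> simp [w, ht₁, ht₂, prod.lift_fst, prod.lift_snd]
  have hdesc : hc.left ≫ t ≫ f ≫ y = hc.right ≫ t ≫ f ≫ y := by
    have hlr : (hc.left ≫ t) ≫ w = (hc.right ≫ t) ≫ w := by
      rw [Category.assoc, Category.assoc, htw, reassoc_of% hc.w]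
    simpa [pullback.lift_fst_assoc, pullback.lift_snd_assoc] using
      hSeq (pullback.lift _ _ hlr) (hc.left ≫ c ≫ prod.fst ≫ j)
        (by simp [pullback.lift_fst_assoc, ht₁])
  obtain ⟨e, he⟩ := hc.desc' _ hdesc
  refine ⟨W, hW, e, fun {Z} hZ g => ?_⟩
  obtain ⟨V', d, hV', hd⟩ := cover (pullback g y)
  have hg : Nonempty (RegularEpi (pullback.fst g y)) :=
    ExactCategory.regEpiStable y g _ _ (IsPullback.of_hasPullback g y).flip hy
  let d' : V' ⟶ Z ⨯ X := d ≫ pullback.fst g y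
  let f' : V' ⟶ Y := d ≫ pullback.snd g y
  have hf'y : f' ≫ y = d' ≫ g := by simp [f', d', pullback.condition]
  have hprod' : IsWeakProductOn P (d' ≫ prod.fst) (d' ≫ prod.snd) := by
    intro A hA a b
    obtain ⟨l, hl⟩ := lift hA _ hg (prod.lift a b)
    obtain ⟨l', hl'⟩ := lift hA _ hd l
    exact ⟨l', by simp [d', reassoc_of% hl', reassoc_of% hl, prod.lift_fst],
      by simp [d', reassoc_of% hl', reassoc_of% hl, prod.lift_snd]⟩
  obtain ⟨h, Q, -, q₁, q₂, k, ⟨-, hQ⟩, hk₁, hk₂, hkf⟩ := hf hZ hV' _ _ f' hprod'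
  have eval {A : E} (hA : P A) (z : A ⟶ Z) (s : A ⟶ V) (hzs : z ≫ h = s ≫ p₁) :
      s ≫ f ≫ y = prod.lift z (s ≫ p₂) ≫ g := by
    obtain ⟨q, rfl, rfl⟩ := hQ hA z s hzs
    have : prod.lift (q ≫ q₁) ((q ≫ q₂) ≫ p₂) = q ≫ k ≫ d' := by
      ext <;> simp [hk₁, hk₂, prod.lift_fst, prod.lift_snd]
    rw [this, Category.assoc, Category.assoc, Category.assoc, ← hf'y, reassoc_of% hkf]
  obtain ⟨l, hl⟩ := hSfac h fun {A} s z hzs => by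
    obtain ⟨A', a, hA', ha⟩ := cover A
    have := ha.some.epi
    have hfst : pullback.fst w w ≫ p₁ = pullback.snd w w ≫ p₁ := by
      simpa only [Category.assoc, hw₁] using pullback.condition (f := w) (g := w) =≫ prod.fst
    have hsnd : pullback.fst w w ≫ p₂ = pullback.snd w w ≫ p₂ := by
      simpa only [Category.assoc, hw₂] using pullback.condition (f := w) (g := w) =≫ prod.snd
    rw [← cancel_epi a]
    have h₁ := eval hA' (a ≫ z) (a ≫ s ≫ pullback.fst w w) (by simp [hzs])
    have h₂ := eval hA' (a ≫ z) (a ≫ s ≫ pullback.snd w w) (by simp [hzs, hfst])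
    simp only [Category.assoc, hsnd] at h₁ h₂ ⊢
    rw [h₁, h₂]
  obtain ⟨h', rfl⟩ := lift hZ j hj l
  refine ⟨h', ?_⟩
  obtain ⟨A, a, hA, ha⟩ := cover (Z ⨯ X)
  have := ha.some.epi
  rw [← cancel_epi a]
  obtain ⟨s, hs⟩ := lift hA c ⟨hc⟩ (a ≫ prod.map h' (𝟙 X))
  have hval := eval hA (a ≫ prod.fst) (s ≫ t) (by simp [ht₁, reassoc_of% hs, ← hl])
  have hlift : prod.lift (a ≫ prod.fst) ((s ≫ t) ≫ p₂) = a := by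
    ext <;> simp [ht₂, reassoc_of% hs, prod.lift_fst, prod.lift_snd]
  rw [hlift] at hval
  rw [← hval, ← Category.assoc, ← hs, Category.assoc, he, Category.assoc]

end Paper
end

section
/- Let E be an exact category that is cartesian closed and let P be a projective cover of E. Then P has weak exponentials. -/
open CategoryTheory CategoryTheory.Limits

universe v u v₂ u₂

namespace Paper

section

variable {E : Type u} [Category.{v} E]

/-- In an exact category, regular epimorphisms satisfy right cancellation. -/
theorem regularEpi_of_comp [ExactCategory E] {A B D : E} (s : A ⟶ B) (f : B ⟶ D)
    (h : Nonempty (RegularEpi (s ≫ f))) : Nonempty (RegularEpi f) := by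
  obtain ⟨I, e, m, ⟨he⟩, hm, rfl⟩ := ExactCategory.regEpiMonoFactorisation f
  obtain ⟨h⟩ := h
  have : IsRegularEpi (s ≫ e ≫ m) := ⟨⟨h⟩⟩
  have hs : StrongEpi ((s ≫ e) ≫ m) := by
    rw [Category.assoc]
    infer_instance
  have : StrongEpi m := strongEpi_of_strongEpi (s ≫ e) m
  have : IsIso m := isIso_of_mono_of_strongEpi m
  have : IsRegularEpi e := ⟨⟨he⟩⟩
  exact ((MorphismProperty.cancel_right_of_respectsIso
    (MorphismProperty.regularEpi E) e m).2 this).regularEpi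

/-- The comparison map from a weak product in a projective cover to the product
is a regular epimorphism. -/
theorem IsWeakProductOn.regularEpi_lift [ExactCategory E] {P : E → Prop}
    (hP : IsProjectiveCover P) {Z X V : E} {p₁ : V ⟶ Z} {p₂ : V ⟶ X}
    (h : IsWeakProductOn P p₁ p₂) : Nonempty (RegularEpi (prod.lift p₁ p₂)) := by
  obtain ⟨Q, q, hQ, hq⟩ := hP.2 (Z ⨯ X)
  obtain ⟨t, ht₁, ht₂⟩ := h hQ (q ≫ prod.fst) (q ≫ prod.snd)
  refine regularEpi_of_comp t _ ?_
  have : t ≫ prod.lift p₁ p₂ = q := by ext <;> simp [ht₁, ht₂, prod.lift_fst, prod.lift_snd]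
  rwa [this]

/-- A morphism determined by the projections of a weak product in a projective cover
factors through the product. -/
theorem DeterminedByProjectionsOn.exists_factor [ExactCategory E] {P : E → Prop}
    (hP : IsProjectiveCover P) {Z X V Y : E} {p₁ : V ⟶ Z} {p₂ : V ⟶ X} {f : V ⟶ Y}
    (h : IsWeakProductOn P p₁ p₂) (hf : DeterminedByProjectionsOn P p₁ p₂ f) :
    ∃ g : Z ⨯ X ⟶ Y, prod.lift p₁ p₂ ≫ g = f := by
  obtain ⟨r⟩ := h.regularEpi_lift hP
  obtain ⟨Q, q, hQ, ⟨hq⟩⟩ := hP.2 r.W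
  have : IsRegularEpi q := ⟨⟨hq⟩⟩
  have w₁ : r.left ≫ p₁ = r.right ≫ p₁ := by
    simpa [prod.lift_fst] using r.w =≫ prod.fst
  have w₂ : r.left ≫ p₂ = r.right ≫ p₂ := by
    simpa [prod.lift_snd] using r.w =≫ prod.snd
  have w : r.left ≫ f = r.right ≫ f := by
    rw [← cancel_epi q]
    simpa using hf hQ (q ≫ r.left) (q ≫ r.right) (by simp [w₁]) (by simp [w₂])
  exact ⟨r.isColimit.desc (Cofork.ofπ f w), r.isColimit.fac (Cofork.ofπ f w) .one⟩

end

/-- A projective cover of a cartesian closed exact category has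
weak exponentials. -/
theorem projectiveCover_hasWeakExponentials
    {E : Type u} [Category.{v} E] [ExactCategory E]
    (hcc : IsCartesianClosed E)
    (P : E → Prop) (hP : IsProjectiveCover P) :
    HasWeakExponentialsOn P := by
  intro X Y _ _
  obtain ⟨W₀, ev, hev⟩ := hcc X Y
  obtain ⟨W, w, hW, hw⟩ := hP.2 W₀
  obtain ⟨V, v, hV, hv⟩ := hP.2 (W ⨯ X)
  refine ⟨W, V, hW, hV, v ≫ prod.fst, v ≫ prod.snd, v ≫ prod.map w (𝟙 X) ≫ ev, ?_, ?_, ?_⟩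
  · intro Z hZ a b
    obtain ⟨t, ht⟩ := hP.1 hZ v hv (prod.lift a b)
    exact ⟨t, by rw [← Category.assoc, ht, prod.lift_fst],
      by rw [← Category.assoc, ht, prod.lift_snd]⟩
  · intro Z _ a b h₁ h₂
    have h : a ≫ v = b ≫ v := by ext <;> simpa
    rw [← Category.assoc, h, Category.assoc]
  · intro W' V' hW' hV' p₁' p₂' e' hp he
    obtain ⟨g, rfl⟩ := he.exists_factor hP hp
    obtain ⟨h₀, hh₀, -⟩ := hev g
    obtain ⟨h, rfl⟩ := hP.1 hW' w hw h₀
    obtain ⟨k, hk⟩ := hP.1 hV' v hv (prod.lift (p₁' ≫ h) p₂')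
    refine ⟨h, k, by rw [← Category.assoc, hk, prod.lift_fst],
      by rw [← Category.assoc, hk, prod.lift_snd], ?_⟩
    rw [← Category.assoc, hk, ← hh₀]
    simp

end Paper
end

section
/- Let C be a category with weak finite limits. Then C has dependent full diagrams if and only if every slice category C/J has dependent full diagrams. -/
open CategoryTheory CategoryTheory.Limits

universe v u v₂ u₂

namespace Paper

/-- The forgetful functor `Over I ⥤ C` preserves and reflects weak pullbacks. -/
theorem isWeakPullback_left_iff {C : Type u} [Category.{v} C] {I : C} {P A B Z : Over I}
    (q₁ : P ⟶ A) (q₂ : P ⟶ B) (f : A ⟶ Z) (g : B ⟶ Z) :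
    IsWeakPullback q₁.left q₂.left f.left g.left ↔ IsWeakPullback q₁ q₂ f g := by
  constructor
  · rintro ⟨hc, hl⟩
    refine ⟨Over.OverMorphism.ext (by simpa using hc), fun {W} a b hab => ?_⟩
    obtain ⟨t, ht₁, ht₂⟩ := hl a.left b.left (by simpa using congrArg CommaMorphism.left hab)
    exact ⟨Over.homMk t (by rw [← Over.w q₁, ← Category.assoc, ht₁, Over.w]),
      Over.OverMorphism.ext (by simpa using ht₁), Over.OverMorphism.ext (by simpa using ht₂)⟩
  · rintro ⟨hc, hl⟩
    refine ⟨by simpa using congrArg CommaMorphism.left hc, fun {W} a b hab => ?_⟩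
    have hb : b ≫ B.hom = a ≫ A.hom := by
      rw [← Over.w f, ← Over.w g, ← Category.assoc, ← Category.assoc, hab]
    obtain ⟨t, ht₁, ht₂⟩ := hl (W := Over.mk (a ≫ A.hom)) (Over.homMk a) (Over.homMk b hb)
      (Over.OverMorphism.ext (by simpa using hab))
    exact ⟨t.left, by simpa using congrArg CommaMorphism.left ht₁,
      by simpa using congrArg CommaMorphism.left ht₂⟩

/-- The forgetful functor `Over I ⥤ C` preserves and reflects dependent full diagrams. -/
theorem isDepFullDiagram_left_iff {C : Type u} [Category.{v} C] {I : C} {J X Y U V : Over I}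
    (x : X ⟶ J) (y : Y ⟶ X) (u : U ⟶ J) (p₁ : V ⟶ U) (p₂ : V ⟶ X) (f : V ⟶ Y) :
    IsDepFullDiagram x.left y.left u.left p₁.left p₂.left f.left ↔
      IsDepFullDiagram x y u p₁ p₂ f := by
  constructor
  · rintro ⟨hp, hf, hu⟩
    refine ⟨(isWeakPullback_left_iff ..).1 hp, Over.OverMorphism.ext (by simpa using hf),
      fun {U' V'} u' p₁' p₂' f' hp' hf' => ?_⟩
    obtain ⟨h, hh, P, q₁, q₂, k, hP, hk₁, hk₂⟩ := hu u'.left p₁'.left p₂'.left f'.left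
      ((isWeakPullback_left_iff ..).2 hp') (by simpa using congrArg CommaMorphism.left hf')
    have hU : h ≫ U.hom = U'.hom := by rw [← Over.w u, ← Category.assoc, hh, Over.w]
    have hq₂ : q₂ ≫ U'.hom = q₁ ≫ V.hom := by
      rw [← hU, ← Category.assoc, ← hP.1, Category.assoc, Over.w]
    have hk : k ≫ V'.hom = q₁ ≫ V.hom := by
      rw [← hq₂, ← hk₁, Category.assoc, Over.w]
    exact ⟨Over.homMk h hU, Over.OverMorphism.ext (by simpa using hh),
      Over.mk (q₁ ≫ V.hom), Over.homMk q₁, Over.homMk q₂ hq₂, Over.homMk k hk,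
      (isWeakPullback_left_iff ..).1 hP, Over.OverMorphism.ext (by simpa using hk₁),
      Over.OverMorphism.ext (by simpa using hk₂)⟩
  · rintro ⟨hp, hf, hu⟩
    refine ⟨(isWeakPullback_left_iff ..).2 hp, by simpa using congrArg CommaMorphism.left hf,
      fun {U' V'} u' p₁' p₂' f' hp' hf' => ?_⟩
    have hV : p₂' ≫ X.hom = p₁' ≫ u' ≫ J.hom := by
      rw [← Over.w x, ← Category.assoc, ← hp'.1, Category.assoc]
    have hY : f' ≫ Y.hom = p₁' ≫ u' ≫ J.hom := by
      rw [← hV, ← hf', Category.assoc, Over.w]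
    obtain ⟨h, hh, P, q₁, q₂, k, hP, hk₁, hk₂⟩ :=
      hu (U' := Over.mk (u' ≫ J.hom)) (V' := Over.mk (p₁' ≫ u' ≫ J.hom))
        (Over.homMk u') (Over.homMk p₁') (Over.homMk p₂' hV) (Over.homMk f' hY)
        ((isWeakPullback_left_iff ..).1 hp') (Over.OverMorphism.ext (by simpa using hf'))
    exact ⟨h.left, by simpa using congrArg CommaMorphism.left hh, P.left, q₁.left, q₂.left,
      k.left, (isWeakPullback_left_iff ..).2 hP, by simpa using congrArg CommaMorphism.left hk₁,
      by simpa using congrArg CommaMorphism.left hk₂⟩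

/-- A category with weak finite limits has dependent full
diagrams iff every slice category has dependent full diagrams. -/
theorem hasDepFullDiagrams_iff_slices
    {C : Type u} [Category.{v} C] (hwfl : HasWeakFiniteLimits C) :
    HasDepFullDiagrams C ↔ ∀ J : C, HasDepFullDiagrams (Over J) := by
  constructor
  · intro H I J X Y x y
    obtain ⟨U, V, u, p₁, p₂, f, hD⟩ := H x.left y.left
    have hV : p₂ ≫ X.hom = p₁ ≫ u ≫ J.hom := by
      rw [← Over.w x, ← Category.assoc, ← hD.1.1, Category.assoc]
    have hY : f ≫ Y.hom = p₁ ≫ u ≫ J.hom := by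
      rw [← hV, ← hD.2.1, Category.assoc, Over.w]
    exact ⟨Over.mk (u ≫ J.hom), Over.mk (p₁ ≫ u ≫ J.hom), Over.homMk u, Over.homMk p₁,
      Over.homMk p₂ hV, Over.homMk f hY, (isDepFullDiagram_left_iff ..).1 hD⟩
  · intro H J X Y x y
    obtain ⟨U, V, u, p₁, p₂, f, hD⟩ := H J
      (Over.homMk x : Over.mk x ⟶ Over.mk (𝟙 J)) (Over.homMk y : Over.mk (y ≫ x) ⟶ Over.mk x)
    exact ⟨U.left, V.left, u.left, p₁.left, p₂.left, f.left, (isDepFullDiagram_left_iff ..).2 hD⟩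

end Paper
end

section
/- Let E be an exact category with a projective cover P. If P has dependent full diagrams, then E has right adjoints to inverse images along every morphism. (Equivalently: if a category C with weak finite limits has dependent full diagrams, then its exact completion C_ex has right adjoints to inverse images.) -/
open CategoryTheory CategoryTheory.Limits

universe v u v₂ u₂

namespace Paper

section Coverings

variable {E : Type u} [Category.{v} E]

/-- Subobjects are stable under descent along regular epimorphisms. -/
theorem factors_of_regularEpi_comp {W Z B : E} (S : Subobject B) (q : W ⟶ Z)
    (hq : Nonempty (RegularEpi q)) (z : Z ⟶ B) (h : S.Factors (q ≫ z)) : S.Factors z := by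
  have : IsRegularEpi q := ⟨hq⟩
  have sq : CommSq (S.factorThru (q ≫ z) h) q S.arrow z := ⟨by simp⟩
  exact (S.factors_iff z).2 ⟨sq.lift, sq.fac_right⟩

/-- Inclusion of subobjects can be tested on elements defined on a projective cover. -/
theorem IsProjectiveCover.subobject_le {P : E → Prop} (hP : IsProjectiveCover P) {B : E}
    {S T : Subobject B}
    (h : ∀ {W : E}, P W → ∀ b : W ⟶ B, S.Factors b → T.Factors b) : S ≤ T := by
  obtain ⟨W, p, hW, hp⟩ := hP.2 (S : E)
  have hT : T.Factors S.arrow := factors_of_regularEpi_comp T p hp _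
    (h hW _ (S.factors_of_factors_right p S.factors_self))
  exact Subobject.le_of_comm (T.factorThru _ hT) (by simp)

theorem factors_pullback_iff [HasPullbacks E] {A B W : E} (f : A ⟶ B)
    (T : Subobject B) (a : W ⟶ A) :
    ((Subobject.pullback f).obj T).Factors a ↔ T.Factors (a ≫ f) := by
  have hpb := Subobject.isPullback f T
  constructor
  · intro h
    refine (T.factors_iff _).2 ⟨Subobject.factorThru _ a h ≫ Subobject.pullbackπ f T, ?_⟩
    change (_ ≫ _) ≫ T.arrow = _
    rw [Category.assoc, hpb.w, Subobject.factorThru_arrow_assoc]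
  · intro h
    exact (Subobject.factors_iff _ _).2 ⟨hpb.lift (T.factorThru _ h) a (by simp),
      hpb.lift_snd _ _ _⟩

/-- A pointwise right adjoint to an inverse image map makes it a left adjoint functor. -/
theorem pullback_isLeftAdjoint_of_forall_exists [HasPullbacks E] {A B : E} (f : A ⟶ B)
    (h : ∀ S : Subobject A, ∃ T : Subobject B, ∀ T' : Subobject B,
      (Subobject.pullback f).obj T' ≤ S ↔ T' ≤ T) :
    (Subobject.pullback f).IsLeftAdjoint := by
  choose r hr using h
  have hmono : Monotone r := fun S S' hS =>
    (hr S' (r S)).1 (((hr S (r S)).2 le_rfl).trans hS)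
  exact (Adjunction.mkOfHomEquiv (F := Subobject.pullback f) (G := hmono.functor)
    { homEquiv := fun T S =>
        { toFun := fun g => homOfLE ((hr S T).1 (leOfHom g))
          invFun := fun g => homOfLE ((hr S T).2 (leOfHom g))
          left_inv := fun _ => Subsingleton.elim _ _
          right_inv := fun _ => Subsingleton.elim _ _ }
      homEquiv_naturality_left_symm := fun _ _ => Subsingleton.elim _ _
      homEquiv_naturality_right := fun _ _ => Subsingleton.elim _ _ }).isLeftAdjoint

end Coverings

/-- If a projective cover `P` of an exact category `E` has
dependent full diagrams, then `E` has right adjoints to inverse images along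
every morphism. -/
theorem rightAdjoints_of_depFullDiagrams
    {E : Type u} [Category.{v} E] [ExactCategory E]
    (P : E → Prop) (hP : IsProjectiveCover P)
    (hfull : HasDepFullDiagramsOn P) :
    ∀ {A B : E} (f : A ⟶ B), (Subobject.pullback f).IsLeftAdjoint := by
  intro A B f
  refine pullback_isLeftAdjoint_of_forall_exists f fun S => ?_
  obtain ⟨J, β, hJ, hβ⟩ := hP.2 B
  obtain ⟨X, c, hX, hc⟩ := hP.2 (pullback β f)
  obtain ⟨Y, d, hY, hd⟩ := hP.2 (pullback S.arrow (c ≫ pullback.snd β f))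
  obtain ⟨U, V, -, -, u, p₁, p₂, g, hwp, hg, huniv⟩ :=
    hfull hJ hX hY (c ≫ pullback.fst β f) (d ≫ pullback.snd _ _)
  obtain ⟨I, e, m, he, hm, hem⟩ := ExactCategory.regEpiMonoFactorisation (u ≫ β)
  refine ⟨Subobject.mk m, fun T' => ⟨fun hT' => hP.subobject_le fun {W} hW b hb => ?_,
    fun hT' => hP.subobject_le fun {W} hW a ha => ?_⟩⟩
  · obtain ⟨j, hj⟩ := hP.1 hW β hβ b
    obtain ⟨V', q, hV', hq⟩ := hP.2 (pullback j (c ≫ pullback.fst β f))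
    have hS : S.Factors ((q ≫ pullback.snd _ _) ≫ c ≫ pullback.snd β f) := by
      refine Subobject.factors_of_le _ hT' ((factors_pullback_iff f T' _).2 ?_)
      have : ((q ≫ pullback.snd j (c ≫ pullback.fst β f)) ≫ c ≫ pullback.snd β f) ≫ f =
          (q ≫ pullback.fst _ _) ≫ b := by
        have h₁ := pullback.condition (f := j) (g := c ≫ pullback.fst β f)
        simp only [Category.assoc, ← pullback.condition, ← hj]
        rw [reassoc_of% h₁]
      rw [this]
      exact T'.factors_of_factors_right _ hb
    obtain ⟨g', hg'⟩ := hP.1 hV' d hd (pullback.lift (S.factorThru _ hS)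
      (q ≫ pullback.snd _ _) (by simp))
    obtain ⟨h, hh, -⟩ := huniv hW hV' j (q ≫ pullback.fst _ _) (q ≫ pullback.snd _ _) g'
      ⟨by simp [pullback.condition], fun {Z} hZ a b' hab => by
        obtain ⟨t, ht⟩ := hP.1 hZ q hq (pullback.lift a b' hab)
        exact ⟨t, by rw [reassoc_of% ht, pullback.lift_fst],
          by rw [reassoc_of% ht, pullback.lift_snd]⟩⟩
      (by rw [reassoc_of% hg', pullback.lift_snd])
    rw [Subobject.mk_factors_iff]
    exact ⟨h ≫ e, by simp [hem, reassoc_of% hh, hj]⟩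
  · have ha' := Subobject.factors_of_le _ hT' ((factors_pullback_iff f T' a).1 ha)
    rw [Subobject.mk_factors_iff] at ha'
    obtain ⟨i, hi⟩ := ha'
    obtain ⟨w, hw⟩ := hP.1 hW e he i
    have hw' : (w ≫ u) ≫ β = a ≫ f := by
      rw [Category.assoc, ← hem, reassoc_of% hw]; exact hi
    obtain ⟨x, hx⟩ := hP.1 hW c hc (pullback.lift (w ≫ u) a hw')
    obtain ⟨t, -, ht⟩ := hwp.2 hW w x (by rw [reassoc_of% hx, pullback.lift_fst])
    have h₂ := pullback.condition (f := S.arrow) (g := c ≫ pullback.snd β f)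
    refine (S.factors_iff a).2 ⟨t ≫ g ≫ d ≫ pullback.fst _ _, ?_⟩
    change (t ≫ g ≫ d ≫ pullback.fst _ _) ≫ S.arrow = a
    simp only [Category.assoc] at hg ⊢
    rw [h₂, reassoc_of% hg, reassoc_of% ht, reassoc_of% hx, pullback.lift_snd]

end Paper
end
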